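/- Let H′ = −Σ_{u∈Λ} (J_x X_u X_{u+e_x} + J_y Y_u Y_{u+e_y} + h_x X_u + h_y Y_u + h_z Z_u) with J_x ≠ 0, J_y ≠ 0 and arbitrary (h_x,h_y,h_z) ∈ ℝ³. Let 2 ≤ k̄ ≤ L/2 and let Q = Σ_{A∈P_Λ, Diag A ≤ k̄} q_A A satisfy [H′,Q] = 0. Then for every Pauli product A with Diag A = k̄, q_A = 0 unless A equals C^{k̄}_1 or C^{k̄}_2 based at some site; that is, the first-step conclusion (Lemma on standard forms) for the zero-field model remains valid in the presence of an arbitrary uniform magnetic field. -/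

import Mathlib

open Complex Matrix

/-- Sites of the `L × L` square lattice with periodic boundary conditions. -/
abbrev Site (L : ℕ) := ZMod L × ZMod L

/-- A specification of a product of Pauli matrices: at each site either
`0` (no operator), `1` (`X`), `2` (`Y`) or `3` (`Z`). -/
abbrev PSpec (L : ℕ) := Site L → Fin 4

/-- Operators on the Hilbert space `⊗_{u ∈ Λ} ℂ²`. -/
abbrev Op (L : ℕ) := Matrix (Site L → Fin 2) (Site L → Fin 2) ℂ

/-- The Pauli matrices (`0` gives the identity). -/
noncomputable def pauli (w : Fin 4) : Matrix (Fin 2) (Fin 2) ℂ :=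
  if w = 1 then !![0, 1; 1, 0]
  else if w = 2 then !![0, -Complex.I; Complex.I, 0]
  else if w = 3 then !![1, 0; 0, -1]
  else 1

/-- The product of Pauli matrices specified by `σ`, as an operator (matrix)
on the full Hilbert space. -/
noncomputable def PauliOp (L : ℕ) [NeZero L] (σ : PSpec L) : Op L :=
  fun s t => ∏ u : Site L, pauli (σ u) (s u) (t u)

/-- `DiagBoundAt L σ a k` : every site `u` in the support of `σ` satisfies
`0 ≤ uₓ + u_y − a ≤ k − 1 (mod L)`. -/
def DiagBoundAt (L : ℕ) (σ : PSpec L) (a : ZMod L) (k : ℕ) : Prop :=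
  ∀ u : Site L, σ u ≠ 0 → (u.1 + u.2 - a).val < k

/-- The diagonal length of a Pauli product. -/
noncomputable def Diag (L : ℕ) (σ : PSpec L) : ℕ :=
  sInf {k | ∃ a : ZMod L, DiagBoundAt L σ a k}

/-- `X_u` as a Pauli-product specification. -/
def sigX (L : ℕ) (u : Site L) : PSpec L := fun v => if v = u then 1 else 0
/-- `Y_u` as a Pauli-product specification. -/
def sigY (L : ℕ) (u : Site L) : PSpec L := fun v => if v = u then 2 else 0
/-- `Z_u` as a Pauli-product specification. -/
def sigZ (L : ℕ) (u : Site L) : PSpec L := fun v => if v = u then 3 else 0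
/-- A single-site Pauli operator `W_u` (`w ∈ {1,2,3}`). -/
def sigW (L : ℕ) (u : Site L) (w : Fin 4) : PSpec L := fun v => if v = u then w else 0

/-- `X_u X_{u+eₓ}` as a Pauli-product specification. -/
def sigXX (L : ℕ) (u : Site L) : PSpec L :=
  fun v => if v = u then 1 else if v = u + (1, 0) then 1 else 0
/-- `Y_u Y_{u+e_y}` as a Pauli-product specification. -/
def sigYY (L : ℕ) (u : Site L) : PSpec L :=
  fun v => if v = u then 2 else if v = u + (0, 1) then 2 else 0

/-- The quantum compass Hamiltonian
`H = −Σ_u (Jx X_u X_{u+eₓ} + Jy Y_u Y_{u+e_y})`. -/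
noncomputable def Hcompass (L : ℕ) [NeZero L] (Jx Jy : ℝ) : Op L :=
  - ∑ u : Site L, ((Jx : ℂ) • PauliOp L (sigXX L u) + (Jy : ℂ) • PauliOp L (sigYY L u))

/-- The quantum compass Hamiltonian with a uniform magnetic field. -/
noncomputable def Hfield (L : ℕ) [NeZero L] (Jx Jy hx hy hz : ℝ) : Op L :=
  - ∑ u : Site L,
      ((Jx : ℂ) • PauliOp L (sigXX L u) + (Jy : ℂ) • PauliOp L (sigYY L u)
        + (hx : ℂ) • PauliOp L (sigX L u) + (hy : ℂ) • PauliOp L (sigY L u)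
        + (hz : ℂ) • PauliOp L (sigZ L u))

/-- The candidate conserved quantity `Q = Σ_σ q_σ σ`. -/
noncomputable def Qop (L : ℕ) [NeZero L] (q : PSpec L → ℂ) : Op L :=
  ∑ σ : PSpec L, q σ • PauliOp L σ

/-- Commutator of operators. -/
noncomputable def opComm (L : ℕ) [NeZero L] (A B : Op L) : Op L := A * B - B * A

/-- The coefficient `λ_{σ,τ}` of the Pauli product `τ` in the expansion
`[H, σ] = Σ_τ λ_{σ,τ} τ`, extracted via the (normalized) trace inner product. -/
noncomputable def lam (L : ℕ) [NeZero L] (H : Op L) (σ τ : PSpec L) : ℂ :=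
  Matrix.trace (PauliOp L τ * opComm L H (PauliOp L σ)) / (2 ^ Fintype.card (Site L))

/-- `u` is a top-right site of `σ` (relative to the witness `a` for diagonal
length `k`). -/
def IsTopRight (L : ℕ) (σ : PSpec L) (a : ZMod L) (k : ℕ) (u : Site L) : Prop :=
  σ u ≠ 0 ∧ (u.1 + u.2 - a).val = k - 1

/-- `u` is a bottom-left site of `σ` (relative to the witness `a`). -/
def IsBottomLeft (L : ℕ) (σ : PSpec L) (a : ZMod L) (u : Site L) : Prop :=
  σ u ≠ 0 ∧ (u.1 + u.2 - a).val = 0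

/-- Condition (1): `σ` has a unique top-right site `ū`, with
(1a) `σ_ū = X` and `ū − eₓ ∈ Supp σ`, or (1b) `σ_ū = Y` and `ū − e_y ∈ Supp σ`. -/
def Cond1 (L : ℕ) (σ : PSpec L) (a : ZMod L) (k : ℕ) : Prop :=
  ∃ ub : Site L, (∀ v : Site L, IsTopRight L σ a k v ↔ v = ub) ∧
    ((σ ub = 1 ∧ σ (ub - (1, 0)) ≠ 0) ∨ (σ ub = 2 ∧ σ (ub - (0, 1)) ≠ 0))

/-- Condition (2): `σ` has a unique bottom-left site `u̲`, with
(2a) `σ_u̲ = X` and `u̲ + eₓ ∈ Supp σ`, or (2b) `σ_u̲ = Y` and `u̲ + e_y ∈ Supp σ`. -/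
def Cond2 (L : ℕ) (σ : PSpec L) (a : ZMod L) : Prop :=
  ∃ lb : Site L, (∀ v : Site L, IsBottomLeft L σ a v ↔ v = lb) ∧
    ((σ lb = 1 ∧ σ (lb + (1, 0)) ≠ 0) ∨ (σ lb = 2 ∧ σ (lb + (0, 1)) ≠ 0))

/-- `ShiftRel L k σ σ'` : `σ` has diagonal length `k`, satisfies conditions (1)
and (2), and `σ'` is the Shiraishi shift `S(σ)`, obtained by first appending a
site at the top right (the product `B`) and then truncating the bottom-left site. -/
def ShiftRel (L : ℕ) [NeZero L] (k : ℕ) (σ σ' : PSpec L) : Prop :=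
  Diag L σ = k ∧ σ' ≠ 0 ∧
  ∃ a : ZMod L, DiagBoundAt L σ a k ∧
  ∃ ub lb : Site L,
    (∀ v : Site L, IsTopRight L σ a k v ↔ v = ub) ∧
    (∀ v : Site L, IsBottomLeft L σ a v ↔ v = lb) ∧
    ∃ B : Op L,
      ((σ ub = 1 ∧ σ (ub - (1, 0)) ≠ 0 ∧
          B = (-(1 / (2 * Complex.I))) • opComm L (PauliOp L (sigYY L ub)) (PauliOp L σ)) ∨
       (σ ub = 2 ∧ σ (ub - (0, 1)) ≠ 0 ∧
          B = (1 / (2 * Complex.I)) • opComm L (PauliOp L (sigXX L ub)) (PauliOp L σ))) ∧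
      ∃ ε : ℂ, (ε = 1 / (2 * Complex.I) ∨ ε = -(1 / (2 * Complex.I))) ∧
        ((σ lb = 1 ∧ σ (lb + (1, 0)) ≠ 0 ∧
            PauliOp L σ' = ε • opComm L (PauliOp L (sigXX L lb)) B) ∨
         (σ lb = 2 ∧ σ (lb + (0, 1)) ≠ 0 ∧
            PauliOp L σ' = ε • opComm L (PauliOp L (sigYY L lb)) B))

/-- The staircase sequence `u_j`: `u_j = u₁ + ((j−1)/2)(eₓ+e_y)` for odd `j`,
and `u_j = u₁ + (j/2)(eₓ+e_y) − e_y` for even `j`. -/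
def stair (L : ℕ) (u1 : Site L) (j : ℕ) : Site L :=
  if j % 2 = 1 then
    u1 + ((((j - 1) / 2 : ℕ) : ZMod L), (((j - 1) / 2 : ℕ) : ZMod L))
  else
    u1 + (((j / 2 : ℕ) : ZMod L), ((j / 2 : ℕ) : ZMod L)) - ((0 : ZMod L), (1 : ZMod L))

/-- The Pauli letter at the first (bottom-left) end of `C^k_j`. -/
def endL (j : ℕ) : Fin 4 := if j % 2 = 1 then 1 else 2

/-- The Pauli letter at the last (top-right) end of `C^k_j`. -/
def endR (k j : ℕ) : Fin 4 :=
  if k % 2 = 1 then (if j % 2 = 1 then 2 else 1)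
  else (if j % 2 = 1 then 1 else 2)

/-- The standard-form product `C^k_j` based at `u₁`: the appropriate end
letters at `u_j` and `u_{j+k−1}`, and `Z` at `u_{j+1}, …, u_{j+k−2}`. -/
def Cspec (L : ℕ) (k j : ℕ) (u1 : Site L) : PSpec L := fun v =>
  if v = stair L u1 j then endL j
  else if v = stair L u1 (j + k - 1) then endR k j
  else if v ∈ (Finset.Icc (j + 1) (j + k - 2)).image (stair L u1) then 3
  else 0

/-! ### Multiplication of Pauli products up to phase -/

/-- The phase in `pauli a * pauli b = pauliPhase a b • pauli (a ^^^ b)`. -/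
noncomputable def pauliPhase (a b : Fin 4) : ℂ :=
  if a = 0 ∨ b = 0 ∨ a = b then 1
  else if (a = 1 ∧ b = 2) ∨ (a = 2 ∧ b = 3) ∨ (a = 3 ∧ b = 1) then Complex.I
  else -Complex.I

/-- The commutation sign of two Pauli letters. -/
def pauliSign (a b : Fin 4) : ℂ :=
  if a = 0 ∨ b = 0 ∨ a = b then 1 else -1

lemma pauli_mul (a b : Fin 4) :
    pauli a * pauli b = pauliPhase a b • pauli (a ^^^ b) := by
  fin_cases a <;> fin_cases b <;> ext i j <;> fin_cases i <;> fin_cases j <;>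
    simp [pauli, pauliPhase, Matrix.mul_apply, Fin.sum_univ_two]

lemma pauliPhase_ne_zero (a b : Fin 4) : pauliPhase a b ≠ 0 := by
  unfold pauliPhase
  split_ifs <;> simp

lemma pauliPhase_self (a : Fin 4) : pauliPhase a a = 1 := by
  simp [pauliPhase]

lemma pauliPhase_comm (a b : Fin 4) :
    pauliPhase a b = pauliSign a b * pauliPhase b a := by
  fin_cases a <;> fin_cases b <;> simp [pauliPhase, pauliSign]

lemma pauliSign_xor_right (a b : Fin 4) : pauliSign a (a ^^^ b) = pauliSign a b := by
  have h : ((a = 0 ∨ a ^^^ b = 0 ∨ a = a ^^^ b) ↔ (a = 0 ∨ b = 0 ∨ a = b)) := by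
    revert a b; decide
  simp only [pauliSign, h]

lemma trace_pauli (a : Fin 4) : Matrix.trace (pauli a) = if a = 0 then 2 else 0 := by
  fin_cases a <;> simp [pauli, Matrix.trace, Fin.sum_univ_two]

/-- The product of two Pauli products, forgetting the phase. -/
def specMul {L : ℕ} (σ τ : PSpec L) : PSpec L := fun u => σ u ^^^ τ u

lemma specMul_specMul_cancel {L : ℕ} (σ τ : PSpec L) : specMul σ (specMul σ τ) = τ := by
  have : ∀ a b : Fin 4, a ^^^ (a ^^^ b) = b := by decide
  funext u; exact this _ _

section PauliAlgebra

variable {L : ℕ} [NeZero L]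

/-- The phase of a product of two Pauli products. -/
noncomputable def specPhase (σ τ : PSpec L) : ℂ := ∏ u, pauliPhase (σ u) (τ u)

/-- The commutation sign of two Pauli products. -/
noncomputable def specSign (σ τ : PSpec L) : ℂ := ∏ u, pauliSign (σ u) (τ u)

lemma PauliOp_mul (σ τ : PSpec L) :
    PauliOp L σ * PauliOp L τ = specPhase σ τ • PauliOp L (specMul σ τ) := by
  ext s t
  simp only [Matrix.mul_apply, PauliOp, Matrix.smul_apply, smul_eq_mul, specPhase, specMul,
    ← Finset.prod_mul_distrib]
  have h : ∀ u, pauliPhase (σ u) (τ u) * pauli (σ u ^^^ τ u) (s u) (t u)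
      = ∑ r : Fin 2, pauli (σ u) (s u) r * pauli (τ u) r (t u) := fun u => by
    rw [← Matrix.mul_apply, pauli_mul]; rfl
  simp_rw [h]
  rw [Finset.prod_univ_sum]
  simp

lemma trace_PauliOp (σ : PSpec L) :
    Matrix.trace (PauliOp L σ) = if σ = 0 then 2 ^ Fintype.card (Site L) else 0 := by
  have h : Matrix.trace (PauliOp L σ) = ∏ u, Matrix.trace (pauli (σ u)) := by
    simp only [Matrix.trace, Matrix.diag, PauliOp]
    rw [Finset.prod_univ_sum]
    simp
  rw [h]
  simp_rw [trace_pauli]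
  split_ifs with h0
  · subst h0; simp
  · obtain ⟨u, hu⟩ := Function.ne_iff.mp h0
    exact Finset.prod_eq_zero (Finset.mem_univ u) (if_neg hu)

lemma specPhase_ne_zero (σ τ : PSpec L) : specPhase σ τ ≠ 0 :=
  Finset.prod_ne_zero_iff.mpr fun _ _ => pauliPhase_ne_zero _ _

lemma opComm_PauliOp (σ τ : PSpec L) :
    opComm L (PauliOp L σ) (PauliOp L τ)
      = ((specSign σ τ - 1) * specPhase τ σ) • PauliOp L (specMul σ τ) := by
  have h1 : specMul τ σ = specMul σ τ := by
    have : ∀ a b : Fin 4, a ^^^ b = b ^^^ a := by decide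
    funext u; exact this _ _
  have h2 : specPhase σ τ = specSign σ τ * specPhase τ σ := by
    simp only [specPhase, specSign, ← Finset.prod_mul_distrib]
    exact Finset.prod_congr rfl fun u _ => pauliPhase_comm _ _
  rw [opComm, PauliOp_mul, PauliOp_mul, h1, h2, ← sub_smul]
  congr 1; ring

lemma trace_PauliOp_mul (σ τ : PSpec L) :
    Matrix.trace (PauliOp L σ * PauliOp L τ)
      = if τ = σ then 2 ^ Fintype.card (Site L) else 0 := by
  rw [PauliOp_mul, Matrix.trace_smul, trace_PauliOp]
  have h : specMul σ τ = 0 ↔ τ = σ := by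
    have : ∀ a b : Fin 4, a ^^^ b = 0 ↔ b = a := by decide
    simp only [funext_iff, specMul, Pi.zero_apply, this]
  by_cases h0 : τ = σ
  · subst h0
    simp [h, specPhase, pauliPhase_self]
  · simp [h, h0]

lemma specSign_specMul_right (σ τ : PSpec L) : specSign σ (specMul σ τ) = specSign σ τ :=
  Finset.prod_congr rfl fun _ _ => pauliSign_xor_right _ _

/-- If a Hamiltonian that is a combination of Pauli products commutes with `Qop L q`, and the
contribution of the term `i` to the coefficient of `B` in the commutator does not vanish, then
some other term contributes too. -/
lemma exists_other_contribution {ι : Type*} [Fintype ι] (J : ι → ℂ) (h : ι → PSpec L)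
    (q : PSpec L → ℂ)
    (hcons : opComm L (-∑ i, J i • PauliOp L (h i)) (Qop L q) = 0)
    (B : PSpec L) (i : ι) (hJ : J i ≠ 0) (hq : q (specMul (h i) B) ≠ 0)
    (hs : specSign (h i) B ≠ 1) :
    ∃ j, j ≠ i ∧ q (specMul (h j) B) ≠ 0 ∧ specSign (h j) B ≠ 1 := by
  classical
  have hexp : opComm L (-∑ i, J i • PauliOp L (h i)) (Qop L q)
      = -∑ i, ∑ σ, (J i * q σ) • opComm L (PauliOp L (h i)) (PauliOp L σ) := by
    simp only [opComm, Qop, neg_mul, mul_neg, Finset.sum_mul_sum, smul_sub,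
      Finset.sum_sub_distrib, smul_mul_smul_comm]
    rw [Finset.sum_comm (f := fun σ i => (q σ * J i) • (PauliOp L σ * PauliOp L (h i)))]
    simp only [mul_comm (q _)]
    abel
  have hsum : ∑ i, J i * q (specMul (h i) B)
      * ((specSign (h i) B - 1) * specPhase (specMul (h i) B) (h i)) = 0 := by
    have htr := congrArg (fun M => Matrix.trace (PauliOp L B * M)) (hexp.symm.trans hcons)
    simp only [opComm_PauliOp, mul_neg, Finset.mul_sum, Matrix.trace_neg, Matrix.trace_sum,
      Matrix.mul_smul, Matrix.trace_smul, trace_PauliOp_mul, smul_eq_mul, mul_zero,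
      Matrix.trace_zero, neg_eq_zero] at htr
    have hN : (2 : ℂ) ^ Fintype.card (Site L) ≠ 0 := by simp
    have hin : ∀ i, ∑ σ, J i * q σ * ((specSign (h i) σ - 1) * specPhase σ (h i)
          * if specMul (h i) σ = B then (2 : ℂ) ^ Fintype.card (Site L) else 0)
        = (J i * q (specMul (h i) B) * ((specSign (h i) B - 1)
          * specPhase (specMul (h i) B) (h i))) * 2 ^ Fintype.card (Site L) := by
      intro i
      rw [Finset.sum_eq_single (specMul (h i) B)]
      · rw [specMul_specMul_cancel, if_pos rfl, specSign_specMul_right]; ring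
      · intro σ _ hσ
        rw [if_neg]
        · simp
        · rintro rfl
          exact hσ (specMul_specMul_cancel _ _).symm
      · simp
    simp_rw [hin] at htr
    rw [← Finset.sum_mul] at htr
    exact (mul_eq_zero.mp htr).resolve_right hN
  by_contra! hcon
  rw [Finset.sum_eq_single i] at hsum
  · exact (mul_ne_zero (mul_ne_zero hJ hq)
      (mul_ne_zero (sub_ne_zero.mpr hs) (specPhase_ne_zero _ _))) hsum
  · intro j _ hj
    by_cases hqj : q (specMul (h j) B) = 0
    · simp [hqj]
    · simp [hcon j hj hqj]
  · simp

end PauliAlgebra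

/-! ### Bonds and the staircase -/

/-- The letter carried by a bond: `X` for `true`, `Y` for `false`. -/
def bondLetter (t : Bool) : Fin 4 := if t then 1 else 2

/-- The lattice direction of a bond. -/
def bondDir (L : ℕ) (t : Bool) : Site L := if t then (1, 0) else (0, 1)

/-- The two-site interaction on the bond of direction `t` starting at `x`. -/
def bond (L : ℕ) (t : Bool) (x : Site L) : PSpec L := fun v =>
  if v = x then bondLetter t else if v = x + bondDir L t then bondLetter t else 0

/-- The diagonal on which a site lies. -/
def diagOf {L : ℕ} (x : Site L) : ZMod L := x.1 + x.2

lemma diagOf_add_bondDir {L : ℕ} (x : Site L) (t : Bool) :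
    diagOf (x + bondDir L t) = diagOf x + 1 := by
  cases t <;> simp [diagOf, bondDir] <;> ring

lemma bondLetter_ne_zero (t : Bool) : bondLetter t ≠ 0 := by cases t <;> decide

/-- The direction of the `j`-th step of a staircase starting in direction `t`. -/
def stepType (t : Bool) (j : ℕ) : Bool := if j % 2 = 0 then t else !t

/-- The staircase starting at `u` in direction `t`. -/
def walk {L : ℕ} (u : Site L) (t : Bool) : ℕ → Site L
  | 0 => u
  | j + 1 => walk u t j + bondDir L (stepType t j)

lemma stepType_succ (t : Bool) (j : ℕ) : stepType t (j + 1) = stepType (!t) j := by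
  unfold stepType
  rcases Nat.mod_two_eq_zero_or_one j with h | h
  · have : (j + 1) % 2 = 1 := by omega
    simp [h, this]
  · have : (j + 1) % 2 = 0 := by omega
    simp [h, this]

lemma stepType_not (t : Bool) (j : ℕ) : stepType (!t) j = !stepType t j := by
  unfold stepType; split_ifs <;> simp

lemma walk_succ_left {L : ℕ} (u : Site L) (t : Bool) (j : ℕ) :
    walk u t (j + 1) = walk (u + bondDir L t) (!t) j := by
  induction j with
  | zero => simp [walk, stepType]
  | succ j ih => rw [walk, ih, stepType_succ, walk]

lemma diagOf_walk {L : ℕ} (u : Site L) (t : Bool) (j : ℕ) :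
    diagOf (walk u t j) = diagOf u + j := by
  induction j with
  | zero => simp [walk]
  | succ j ih => rw [walk, diagOf_add_bondDir, ih]; push_cast; ring

lemma stair_eq_walk {L : ℕ} (u : Site L) (j : ℕ) : stair L u (1 + j) = walk u true j := by
  induction j with
  | zero => simp [walk, stair]
  | succ j ih =>
    rw [walk, ← ih]
    rcases Nat.even_or_odd' j with ⟨i, rfl | rfl⟩
    · have h1 : (1 + 2 * i) % 2 = 1 := by omega
      have h2 : ¬ (1 + (2 * i + 1)) % 2 = 1 := by omega
      have h3 : (1 + 2 * i - 1) / 2 = i := by omega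
      have h4 : (1 + (2 * i + 1)) / 2 = i + 1 := by omega
      simp only [stair, if_pos h1, if_neg h2, h3, h4, stepType, bondDir]
      ext <;> simp <;> ring
    · have h1 : ¬ (1 + (2 * i + 1)) % 2 = 1 := by omega
      have h2 : (1 + (2 * i + 1 + 1)) % 2 = 1 := by omega
      have h3 : (1 + (2 * i + 1)) / 2 = i + 1 := by omega
      have h4 : (1 + (2 * i + 1 + 1) - 1) / 2 = i + 1 := by omega
      have h5 : ¬ (2 * i + 1) % 2 = 0 := by omega
      simp only [stair, if_neg h1, if_pos h2, h3, h4, stepType, bondDir, if_neg h5]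
      ext <;> simp

lemma stair_two_add_eq_walk {L : ℕ} (u : Site L) (j : ℕ) :
    stair L u (2 + j) = walk (u + (1, 0)) false j := by
  have h := walk_succ_left u true j
  rw [← stair_eq_walk] at h
  rw [show 2 + j = 1 + (j + 1) by ring, h]
  rfl


/-! ### Diagonal windows -/

section Windows

variable {L : ℕ}

lemma val_natCast_of_eq_add {a d : ZMod L} {j : ℕ} (hj : j < L) (h : d = a + j) :
    (d - a).val = j := by
  rw [h, add_sub_cancel_left, ZMod.val_natCast, Nat.mod_eq_of_lt hj]

lemma eq_of_eq_add_natCast {a d : ZMod L} {i j : ℕ} (hi : i < L) (hj : j < L)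
    (h1 : d = a + i) (h2 : d = a + j) : i = j := by
  rw [← val_natCast_of_eq_add hi h1, val_natCast_of_eq_add hj h2]

lemma DiagBoundAt.mono {σ : PSpec L} {a : ZMod L} {k l : ℕ} (h : DiagBoundAt L σ a k)
    (hkl : k ≤ l) : DiagBoundAt L σ a l :=
  fun u hu => (h u hu).trans_le hkl

lemma Diag_le {σ : PSpec L} {a : ZMod L} {k : ℕ} (h : DiagBoundAt L σ a k) : Diag L σ ≤ k :=
  Nat.sInf_le ⟨a, h⟩

variable [NeZero L]

lemma eq_add_val_sub (a d : ZMod L) : d = a + ((d - a).val : ZMod L) := by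
  rw [ZMod.natCast_zmod_val]; ring

/-- A window of length `k` cannot meet both diagonals `a` and `a + k` when `2 * k ≤ L`. -/
lemma not_diagBoundAt_of_far {k : ℕ} (hkL : 2 * k ≤ L) {σ : PSpec L} {a a' : ZMod L}
    {x y : Site L} (hx : diagOf x = a) (hy : diagOf y = a + k) (hσx : σ x ≠ 0) (hσy : σ y ≠ 0) :
    ¬ DiagBoundAt L σ a' k := by
  intro h
  have h1 := h x hσx
  have h2 := h y hσy
  change (diagOf x - a').val < k at h1
  change (diagOf y - a').val < k at h2
  have h3 : (diagOf y - a').val = (diagOf x - a').val + k := by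
    apply val_natCast_of_eq_add (by omega)
    rw [hy, hx]; push_cast; rw [ZMod.natCast_zmod_val]; ring
  omega

/-- `σ` is supported in the window of length `k` at `a` and meets both extreme diagonals. -/
def Spans (k : ℕ) (a : ZMod L) (σ : PSpec L) : Prop :=
  DiagBoundAt L σ a k ∧ (∃ x, diagOf x = a ∧ σ x ≠ 0) ∧ ∃ x, diagOf x + 1 = a + (k : ZMod L) ∧ σ x ≠ 0

lemma exists_diagBoundAt_Diag (σ : PSpec L) : ∃ a, DiagBoundAt L σ a (Diag L σ) :=
  Nat.sInf_mem (s := {k | ∃ a : ZMod L, DiagBoundAt L σ a k})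
    ⟨L, 0, fun _ _ => ZMod.val_lt _⟩

/-- Discarding an unoccupied bottom diagonal shortens a window. -/
lemma val_sub_succ_lt {a d : ZMod L} {k : ℕ} (hkL : k ≤ L) (h : (d - a).val < k + 1)
    (hd : d ≠ a) : (d - (a + 1)).val < k := by
  have h0 : (d - a).val ≠ 0 := by
    rw [Ne, ZMod.val_eq_zero, sub_eq_zero]; exact hd
  have : (d - (a + 1)).val = (d - a).val - 1 := by
    apply val_natCast_of_eq_add (by omega)
    rw [Nat.cast_sub (by omega), ZMod.natCast_zmod_val]; push_cast; ring
  omega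

lemma exists_spans_Diag {σ : PSpec L} {k : ℕ} (hk : 2 ≤ k) (hkL : 2 * k ≤ L)
    (h : Diag L σ = k) : ∃ a, Spans k a σ := by
  obtain ⟨a, ha⟩ := exists_diagBoundAt_Diag σ
  rw [h] at ha
  obtain ⟨m, rfl⟩ : ∃ m, k = m + 1 := ⟨k - 1, by omega⟩
  refine ⟨a, ha, ?_, ?_⟩
  · by_contra! hcon
    have : DiagBoundAt L σ (a + 1) m := fun u hu =>
      val_sub_succ_lt (by omega) (ha u hu) fun hd => hu (hcon u hd)
    have := Diag_le this
    omega
  · by_contra! hcon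
    have : DiagBoundAt L σ a m := by
      intro u hu
      have h1 := ha u hu
      by_contra h2
      have h3 : (u.1 + u.2 - a).val = m := by omega
      refine hu (hcon u ?_)
      have := eq_add_val_sub a (u.1 + u.2)
      rw [h3] at this
      change u.1 + u.2 + 1 = _
      rw [this]; push_cast; ring
    have := Diag_le this
    omega

end Windows

/-! ### Terms of the Hamiltonian -/

/-- The Pauli product of a term of the Hamiltonian: a bond or a field term. -/
def hamTerm (L : ℕ) : Site L × (Bool ⊕ Fin 3) → PSpec L
  | (x, .inl t) => bond L t x
  | (x, .inr w) => sigW L x w.succ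

/-- `q` is supported on products of diagonal length at most `k`, and no term of the Hamiltonian
produces an uncompensated contribution to the commutator through a bond. -/
structure IsLocallyConserved (L k : ℕ) [NeZero L] (q : PSpec L → ℂ) : Prop where
  exists_window : ∀ A, q A ≠ 0 → ∃ a, DiagBoundAt L A a k
  exists_compensation : ∀ (B : PSpec L) (v : Site L) (b : Bool),
    q (specMul (bond L b v) B) ≠ 0 → specSign (bond L b v) B ≠ 1 →
      ∃ j, j ≠ (v, Sum.inl b) ∧ q (specMul (hamTerm L j) B) ≠ 0 ∧ specSign (hamTerm L j) B ≠ 1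

lemma isLocallyConserved_of_opComm_eq_zero {L : ℕ} [NeZero L] {Jx Jy hx hy hz : ℝ}
    (hJx : Jx ≠ 0) (hJy : Jy ≠ 0) {k : ℕ} {q : PSpec L → ℂ}
    (hsupp : ∀ σ : PSpec L, q σ ≠ 0 → σ ≠ 0 ∧ Diag L σ ≤ k)
    (hcons : opComm L (Hfield L Jx Jy hx hy hz) (Qop L q) = 0) :
    IsLocallyConserved L k q := by
  refine ⟨fun A hA => ?_, fun B v b h1 h2 => ?_⟩
  · obtain ⟨a, ha⟩ := exists_diagBoundAt_Diag A
    exact ⟨a, ha.mono (hsupp A hA).2⟩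
  · let J : Site L × (Bool ⊕ Fin 3) → ℂ := fun i =>
      i.2.elim (fun t => if t then (Jx : ℂ) else Jy) ![(hx : ℂ), hy, hz]
    have hH : Hfield L Jx Jy hx hy hz = -∑ i, J i • PauliOp L (hamTerm L i) := by
      simp only [Fintype.sum_prod_type, Fintype.sum_sum_type, Fintype.sum_bool,
        Fin.sum_univ_three, Hfield, J]
      congr 1
      refine Finset.sum_congr rfl fun u _ => ?_
      simp only [Sum.elim_inl, Sum.elim_inr, hamTerm, Matrix.cons_val, if_true,
        Bool.false_eq_true, if_false, ← add_assoc]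
      rfl
    rw [hH] at hcons
    refine exists_other_contribution J (hamTerm L) q hcons B (v, Sum.inl b) ?_ h1 h2
    cases b <;> simpa [J]

section Terms

variable {L : ℕ}

lemma ne_add_bondDir (hL : 1 < L) (x : Site L) (t : Bool) : x ≠ x + bondDir L t := by
  have : Fact (1 < L) := ⟨hL⟩
  cases t <;> simp [bondDir, Prod.ext_iff]

variable [NeZero L]

lemma specSign_bond (hL : 1 < L) (t : Bool) (x : Site L) (σ : PSpec L) :
    specSign (bond L t x) σ
      = pauliSign (bondLetter t) (σ x) * pauliSign (bondLetter t) (σ (x + bondDir L t)) := by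
  have hne := ne_add_bondDir hL x t
  unfold specSign
  rw [Finset.prod_eq_mul x (x + bondDir L t) hne]
  · simp [bond]
  · rintro y - ⟨h1, h2⟩
    simp [bond, h1, h2, pauliSign]
  · simp
  · simp

lemma pauliSign_of_anticomm {a b : Fin 4} (ha : a ≠ 0) (hb : b ≠ 0) (hab : b ≠ a) :
    pauliSign a b = -1 := by
  simp [pauliSign, ha, hb, hab.symm]

/-- A term anticommuting with `B` can clear at most one occupied site of `B`. When it clears one,
it is a bond whose other end survives. -/
lemma exists_cleared_site (hL : 1 < L) (j : Site L × (Bool ⊕ Fin 3)) (B : PSpec L)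
    (hs : specSign (hamTerm L j) B ≠ 1) :
    (∀ y, B y ≠ 0 → specMul (hamTerm L j) B y ≠ 0) ∨
    ∃ x c z z', j = (x, Sum.inl c) ∧
      ((z = x ∧ z' = x + bondDir L c) ∨ (z = x + bondDir L c ∧ z' = x)) ∧
      B z = bondLetter c ∧ B z' ≠ 0 ∧ B z' ≠ bondLetter c ∧
      ∀ y, y ≠ z → B y ≠ 0 → specMul (hamTerm L j) B y ≠ 0 := by
  have hxor : ∀ a b : Fin 4, b ≠ a → a ^^^ b ≠ 0 := by decide
  rcases j with ⟨x, c | w⟩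
  · have hne := ne_add_bondDir hL x c
    simp only [hamTerm] at hs ⊢
    have hmul : ∀ y, (y = x ∨ y = x + bondDir L c → B y ≠ bondLetter c) → B y ≠ 0 →
        specMul (bond L c x) B y ≠ 0 := by
      intro y hy hB
      unfold specMul bond
      apply hxor
      split_ifs with h1 h2
      exacts [hy (Or.inl h1), hy (Or.inr h2), hB]
    by_cases hx : B x = bondLetter c
    · have hx' : B (x + bondDir L c) ≠ 0 ∧ B (x + bondDir L c) ≠ bondLetter c := by
        by_contra hcon
        apply hs
        rw [specSign_bond hL, hx]
        rw [not_and_or, not_not, not_not] at hcon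
        rcases hcon with h | h <;> simp [pauliSign, h]
      refine Or.inr ⟨x, c, x, _, rfl, Or.inl ⟨rfl, rfl⟩, hx, hx'.1, hx'.2, fun y hy hB => ?_⟩
      exact hmul y (fun h => (h.resolve_left hy) ▸ hx'.2) hB
    · by_cases hy : B (x + bondDir L c) = bondLetter c
      · have hx' : B x ≠ 0 := by
          intro h
          apply hs
          rw [specSign_bond hL, hy, h]
          simp [pauliSign]
        refine Or.inr ⟨x, c, _, x, rfl, Or.inr ⟨rfl, rfl⟩, hy, hx', hx, fun y hy hB => ?_⟩
        exact hmul y (fun h => (h.resolve_right hy) ▸ hx) hB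
      · left
        intro y hB
        refine hmul y ?_ hB
        rintro (rfl | rfl) <;> assumption
  · left
    intro y hB
    simp only [hamTerm, specMul]
    apply hxor
    rintro h
    simp only [sigW] at h
    split_ifs at h with hyx
    · subst hyx
      apply hs
      unfold specSign
      rw [Finset.prod_eq_single y]
      · simp [hamTerm, sigW, h, pauliSign]
      · intro z _ hz
        simp [hamTerm, sigW, hz, pauliSign]
      · simp
    · exact hB h

/-- Appending a bond at a top site of a product with non-vanishing coefficient must be compensated
by truncating the unique bottom site. -/
lemma exists_shift {k : ℕ} (hk : 2 ≤ k) (hkL : 2 * k ≤ L) {q : PSpec L → ℂ}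
    (hq : IsLocallyConserved L k q) {A : PSpec L} {a : ZMod L} (hqA : q A ≠ 0)
    (hA : Spans k a A) {v : Site L} (hv : diagOf v + 1 = a + k) (hAv : A v ≠ 0) {b : Bool}
    (hb : A v ≠ bondLetter b) :
    ∃ u t, diagOf u = a ∧ A u = bondLetter t ∧ (∀ x, diagOf x = a → A x ≠ 0 → x = u) ∧
      ∃ A', A' = specMul (bond L t u) (specMul (bond L b v) A) ∧ q A' ≠ 0 ∧
        Spans k (a + 1) A' ∧ A' (u + bondDir L t) ≠ 0 ∧
        A' (u + bondDir L t) ≠ bondLetter t ∧ A' v ≠ 0 ∧ A' (v + bondDir L b) ≠ 0 := by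
  have hL : 1 < L := by omega
  obtain ⟨hwin, ⟨x₀, hx₀, hAx₀⟩, -⟩ := hA
  have hzero : ∀ y (j : ℕ), diagOf y = a + (j : ZMod L) → k ≤ j → j < L → A y = 0 := by
    intro y j hy hkj hjL
    by_contra h
    have h1 : (diagOf y - a).val < k := hwin y h
    rw [val_natCast_of_eq_add hjL hy] at h1
    omega
  have hvb : diagOf (v + bondDir L b) = a + k := by rw [diagOf_add_bondDir, hv]
  have hdiag_ne : ∀ y (i j : ℕ), i < L → j < L → diagOf y = a + (i : ZMod L) →
      diagOf y = a + (j : ZMod L) → i = j := fun y i j => eq_of_eq_add_natCast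
  have hv' : diagOf v = a + (k - 1 : ℕ) := by
    rw [Nat.cast_sub (by omega)]; push_cast
    rw [← add_sub_assoc, ← hv]; ring
  have hAvb : A (v + bondDir L b) = 0 := hzero _ k hvb le_rfl (by omega)
  have hne_v := ne_add_bondDir hL v b
  set B := specMul (bond L b v) A with hB
  have hxor : ∀ a b : Fin 4, b ≠ a → a ^^^ b ≠ 0 := by decide
  have hzx : ∀ a : Fin 4, 0 ^^^ a = a := by decide
  have hBv : B v ≠ 0 := by
    simp only [hB, specMul, bond, if_true]
    exact hxor _ _ hb
  have hBvb : B (v + bondDir L b) = bondLetter b := by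
    simp [hB, specMul, bond, hne_v.symm, hAvb]
  have hBother : ∀ y, y ≠ v → y ≠ v + bondDir L b → B y = A y := by
    intro y h1 h2
    simp [hB, specMul, bond, h1, h2, hzx]
  have hBwin : ∀ y, B y ≠ 0 → (diagOf y - a).val < k + 1 := by
    intro y hy
    by_cases h1 : y = v
    · rw [h1]; exact (hwin v hAv).trans (Nat.lt_succ_self k)
    by_cases h2 : y = v + bondDir L b
    · rw [h2, val_natCast_of_eq_add (by omega) hvb]; omega
    · rw [hBother y h1 h2] at hy
      exact (hwin y hy).trans (Nat.lt_succ_self k)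
  have hBbot : ∀ y, diagOf y = a → B y = A y := by
    intro y hy
    have hy0 : diagOf y = a + (0 : ℕ) := by simp [hy]
    refine hBother y ?_ ?_
    · rintro rfl
      have := hdiag_ne _ _ _ (by omega) (by omega) hy0 hv'
      omega
    · rintro rfl
      have := hdiag_ne _ _ _ (by omega) (by omega) hy0 hvb
      omega
  have hBx₀ : B x₀ ≠ 0 := by rwa [hBbot x₀ hx₀]
  have hBtop : ∀ y, diagOf y = a + (k : ZMod L) → B y ≠ 0 → y = v + bondDir L b := by
    intro y hy hBy
    by_contra h2
    by_cases h1 : y = v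
    · subst h1
      have := hdiag_ne _ _ _ (by omega) (by omega) hy hv'
      omega
    · rw [hBother y h1 h2] at hBy
      exact hBy (hzero y k hy le_rfl (by omega))
  have hsign : specSign (bond L b v) B ≠ 1 := by
    rw [hB, specSign_specMul_right, specSign_bond hL, hAvb,
      pauliSign_of_anticomm (bondLetter_ne_zero b) hAv hb]
    simp only [pauliSign, true_or, or_true, if_true]
    norm_num
  obtain ⟨j, hj, hqj, hsj⟩ := hq.exists_compensation B v b
    (by rw [hB, specMul_specMul_cancel]; exact hqA) hsign
  obtain ⟨a', ha'⟩ := hq.exists_window _ hqj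
  rcases exists_cleared_site hL j B hsj with hall | ⟨x, c, z, z', rfl, hzz, hBz, hBz', hBzc, hall⟩
  · exact absurd ha' (not_diagBoundAt_of_far hkL hx₀ hvb (hall _ hBx₀)
      (hall _ (by rw [hBvb]; exact bondLetter_ne_zero b)))
  have hz_ends : z = v + bondDir L b ∨ (∀ y, diagOf y = a → B y ≠ 0 → y = z) := by
    by_contra! hcon
    obtain ⟨h1, y, hy, hBy, hyz⟩ := hcon
    exact not_diagBoundAt_of_far hkL hy hvb (hall _ hyz hBy)
      (hall _ h1.symm (by rw [hBvb]; exact bondLetter_ne_zero b)) ha'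
  rcases hz_ends with rfl | huniq
  · exfalso
    have hcb : c = b := by
      rw [hBvb] at hBz
      revert hBz
      cases b <;> cases c <;> decide
    subst hcb
    rcases hzz with ⟨rfl, rfl⟩ | ⟨h, rfl⟩
    · have h1 : diagOf (v + bondDir L c + bondDir L c) = a + (k + 1 : ℕ) := by
        rw [diagOf_add_bondDir, hvb]; push_cast; ring
      have h2 := hBwin _ hBz'
      rw [val_natCast_of_eq_add (by omega) h1] at h2
      omega
    · exact hj (by rw [add_right_cancel h])
  · have hx₀z : x₀ = z := huniq x₀ hx₀ hBx₀
    subst hx₀z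
    rcases hzz with ⟨rfl, rfl⟩ | ⟨h, rfl⟩
    · have hub : diagOf (x₀ + bondDir L c) = a + 1 := by rw [diagOf_add_bondDir, hx₀]
      have hne_x := ne_add_bondDir hL x₀ c
      have hxor2 : ∀ a b : Fin 4, b ≠ 0 → a ^^^ b ≠ a := by decide
      have hne1 : a + 1 ≠ a + (k : ZMod L) := by
        intro h
        have := hdiag_ne (x₀ + bondDir L c) 1 k (by omega) (by omega) (by simpa using hub)
          (hub.trans h)
        omega
      have hA'u : specMul (bond L c x₀) B (x₀ + bondDir L c) ≠ 0 := hall _ hne_x.symm hBz'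
      have hA'v : specMul (bond L c x₀) B (v + bondDir L b) ≠ 0 := by
        refine hall _ ?_ (by rw [hBvb]; exact bondLetter_ne_zero b)
        rintro h
        have := hdiag_ne (v + bondDir L b) 0 k (by omega) (by omega)
          (by rw [h, hx₀]; simp) hvb
        omega
      refine ⟨x₀, c, hx₀, by rw [← hBbot x₀ hx₀, hBz],
        fun y hy hAy => huniq y hy (by rwa [hBbot y hy]), _, rfl, hqj, ⟨?_, ?_, ?_⟩, hA'u, ?_,
        hall v ?_ hBv, hA'v⟩
      · intro y hy
        have hyx : y ≠ x₀ := by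
          rintro rfl
          simp [specMul, bond, hBz] at hy
        have hyB : B y ≠ 0 := by
          by_cases hyu : y = x₀ + bondDir L c
          · rwa [hyu]
          · simpa [specMul, bond, hyx, hyu, hzx] using hy
        exact val_sub_succ_lt (by omega) (hBwin y hyB) fun hd => hyx (huniq y hd hyB)
      · exact ⟨_, hub, hA'u⟩
      · exact ⟨_, by rw [hvb]; ring, hA'v⟩
      · simp only [specMul, bond, hne_x.symm, if_true, if_false]
        exact hxor2 _ _ hBz'
      · rintro rfl
        have := hdiag_ne v 0 (k - 1) (by omega) (by omega) (by simp [hx₀]) hv'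
        omega
    · exfalso
      subst h
      have h1 := hBwin _ hBz'
      have h2 := eq_add_val_sub a (diagOf z')
      rw [diagOf_add_bondDir, h2] at hx₀
      have h3 : diagOf z' + 1 = a + ((diagOf z' - a).val + 1 : ℕ) := by
        nth_rewrite 1 [h2]; push_cast; ring
      have h4 := hdiag_ne (z' + bondDir L c) 0 ((diagOf z' - a).val + 1) (by omega) (by omega)
        (by rw [diagOf_add_bondDir, h2]; simpa using hx₀)
        (by rw [diagOf_add_bondDir]; exact h3)
      omega

end Terms

/-! ### Rigidity of the staircase -/

/-- On the `m` lowest diagonals, starting at `a`, the product `A` is the staircase starting at `u`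
in direction `t`. -/
def OnWalk {L : ℕ} (m : ℕ) (A : PSpec L) (a : ZMod L) (u : Site L) (t : Bool) : Prop :=
  ∀ j < m, ∀ x, diagOf x = a + (j : ZMod L) →
    A x = if x = walk u t j then (if j = 0 then bondLetter t else 3) else 0

lemma bondLetter_injective : Function.Injective bondLetter := by decide

lemma exists_ne_bondLetter (w : Fin 4) : ∃ b, w ≠ bondLetter b := by
  revert w; decide

section Rigidity

variable {L : ℕ}

lemma bondDir_injective (hL : 1 < L) : Function.Injective (bondDir L) := by
  have : Fact (1 < L) := ⟨hL⟩
  intro s t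
  cases s <;> cases t <;> simp [bondDir]

lemma OnWalk.bottom {m : ℕ} {A : PSpec L} {a : ZMod L} {u : Site L} {t : Bool}
    (h : OnWalk m A a u t) (hm : 0 < m) {x : Site L} (hx : diagOf x = a) (hAx : A x ≠ 0) :
    u = x ∧ A x = bondLetter t := by
  have h0 := h 0 hm x (by simp [hx])
  by_cases hxu : x = u
  · subst hxu
    simpa [walk] using h0
  · simp only [walk, hxu, if_false] at h0
    exact absurd h0 hAx

lemma OnWalk.eq_walk {m : ℕ} {A : PSpec L} {a : ZMod L} {u : Site L} {t : Bool}
    (h : OnWalk m A a u t) {j : ℕ} (hj : j < m) {x : Site L} (hx : diagOf x = a + (j : ZMod L))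
    (hAx : A x ≠ 0) : x = walk u t j := by
  by_contra hne
  exact hAx (by rw [h j hj x hx, if_neg hne])

variable [NeZero L]

lemma exists_shift_onWalk {k m : ℕ} (hk : 2 ≤ k) (hkL : 2 * k ≤ L) (hm : 0 < m) {q : PSpec L → ℂ}
    (hq : IsLocallyConserved L k q)
    (ih : ∀ A a, q A ≠ 0 → Spans k a A → ∃ u t, OnWalk m A a u t)
    {A : PSpec L} {a : ZMod L} (hqA : q A ≠ 0)
    (hA : Spans k a A) {v : Site L} (hv : diagOf v + 1 = a + k) (hAv : A v ≠ 0) :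
    ∃ u t b, diagOf u = a ∧ A u = bondLetter t ∧ (∀ x, diagOf x = a → A x ≠ 0 → x = u) ∧
      ∃ A', A' = specMul (bond L t u) (specMul (bond L b v) A) ∧ q A' ≠ 0 ∧
        Spans k (a + 1) A' ∧ A' (u + bondDir L t) ≠ 0 ∧ A' v ≠ 0 ∧ A' (v + bondDir L b) ≠ 0 ∧
        OnWalk m A' (a + 1) (u + bondDir L t) (!t) := by
  obtain ⟨b, hb⟩ := exists_ne_bondLetter (A v)
  obtain ⟨u, t, hu, hAu, huniq, A', hA', hqA', hspan, h1, h2, h3, h4⟩ :=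
    exists_shift hk hkL hq hqA hA hv hAv hb
  obtain ⟨u', t', hw⟩ := ih A' (a + 1) hqA' hspan
  obtain ⟨rfl, ht'⟩ := hw.bottom hm (by rw [diagOf_add_bondDir, hu]) h1
  have : t' = !t := by
    rw [ht'] at h2
    cases t <;> cases t' <;> simp_all
  subst this
  exact ⟨u, t, b, hu, hAu, huniq, A', hA', hqA', hspan, h1, h3, h4, hw⟩

lemma exists_onWalk {k : ℕ} (hk : 2 ≤ k) (hkL : 2 * k ≤ L) {q : PSpec L → ℂ}
    (hq : IsLocallyConserved L k q) (m : ℕ) (hm : m + 2 ≤ k) :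
    ∀ A a, q A ≠ 0 → Spans k a A → ∃ u t, OnWalk (m + 1) A a u t := by
  have hxor : ∀ a b : Fin 4, 0 ^^^ b = a → b = a := by decide
  induction m with
  | zero =>
    intro A a hqA hA
    obtain ⟨v, hv, hAv⟩ := hA.2.2
    obtain ⟨b, hb⟩ := exists_ne_bondLetter (A v)
    obtain ⟨u, t, hu, hAu, huniq, -⟩ := exists_shift hk hkL hq hqA hA hv hAv hb
    refine ⟨u, t, fun j hj x hx => ?_⟩
    obtain rfl : j = 0 := by omega
    rw [Nat.cast_zero, add_zero] at hx
    by_cases hxu : x = u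
    · simp [walk, hxu, hAu]
    · simp only [walk, hxu, if_false]
      by_contra hAx
      exact hxu (huniq x hx hAx)
  | succ m ih =>
    intro A a hqA hA
    obtain ⟨v, hv, hAv⟩ := hA.2.2
    obtain ⟨u, t, b, hu, hAu, huniq, A', hA', -, -, -, -, -, hw⟩ :=
      exists_shift_onWalk hk hkL (Nat.succ_pos m) hq (ih (by omega)) hqA hA hv hAv
    refine ⟨u, t, fun j hj x hx => ?_⟩
    rcases j with _ | i
    · rw [Nat.cast_zero, add_zero] at hx
      by_cases hxu : x = u
      · simp [walk, hxu, hAu]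
      · simp only [walk, hxu, if_false]
        by_contra hAx
        exact hxu (huniq x hx hAx)
    · have hwx := hw i (by omega) x (by rw [hx]; push_cast; ring)
      rw [← walk_succ_left] at hwx
      have hv1 : diagOf v = a + (k - 1 : ℕ) := by
        rw [Nat.cast_sub (by omega), ← add_sub_assoc, ← hv]; push_cast; ring
      have hxu : x ≠ u := by
        rintro rfl
        have := eq_of_eq_add_natCast (i := 0) (by omega) (by omega) (by simpa using hu) hx
        omega
      have hxv : x ≠ v := by
        rintro rfl
        have := eq_of_eq_add_natCast (by omega) (by omega) hx hv1
        omega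
      have hxvb : x ≠ v + bondDir L b := by
        rintro rfl
        rw [diagOf_add_bondDir, hv] at hx
        have := eq_of_eq_add_natCast (by omega) (by omega) hx rfl
        omega
      rw [hA'] at hwx
      simp only [specMul, bond, hxu, hxv, hxvb, if_false] at hwx
      rw [if_neg (Nat.succ_ne_zero i)]
      rcases i with _ | i
      · have hwalk : walk u t (0 + 1) = u + bondDir L t := by simp [walk, stepType]
        rw [hwalk] at hwx ⊢
        by_cases hxt : x = u + bondDir L t
        · simp only [hxt, if_true] at hwx ⊢
          have : ∀ (t : Bool) (w : Fin 4), bondLetter t ^^^ (0 ^^^ w) = bondLetter (!t) → w = 3 := by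
            decide
          exact this _ _ hwx
        · simp only [hxt, if_false] at hwx ⊢
          exact hxor _ _ (hxor _ _ hwx)
      · have hxt : x ≠ u + bondDir L t := by
          rintro rfl
          have := eq_of_eq_add_natCast (i := 1) (by omega) (by omega)
            (by rw [diagOf_add_bondDir, hu]; simp) hx
          omega
        simp only [hxt, if_false, Nat.succ_ne_zero] at hwx
        exact hxor _ _ (hxor _ _ hwx)

/-- A product with non-vanishing coefficient and maximal diagonal length is a full staircase. -/
lemma exists_full_walk {k : ℕ} (hk : 2 ≤ k) (hkL : 2 * k ≤ L) {q : PSpec L → ℂ}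
    (hq : IsLocallyConserved L k q) {A : PSpec L} {a : ZMod L} (hqA : q A ≠ 0)
    (hA : Spans k a A) :
    ∃ u t, diagOf u = a ∧ ∀ j < k, ∀ x, diagOf x = a + (j : ZMod L) →
      A x = if x = walk u t j then
        (if j = 0 then bondLetter t else if j + 1 = k then bondLetter (stepType t (k - 2)) else 3)
        else 0 := by
  have hL : 1 < L := by omega
  obtain ⟨n, rfl⟩ : ∃ n, k = n + 2 := ⟨k - 2, by omega⟩
  have ih := exists_onWalk hk hkL hq n le_rfl
  obtain ⟨v, hv, hAv⟩ := hA.2.2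
  obtain ⟨u, t, b, hu, hAu, huniq, A', hA', hqA', hspan, hA'u, hA'v, hA'vb, hw⟩ :=
    exists_shift_onWalk hk hkL (Nat.succ_pos n) hq ih hqA hA hv hAv
  have hvb : diagOf (v + bondDir L b) + 1 = a + 1 + (n + 2 : ℕ) := by
    rw [diagOf_add_bondDir, hv]; ring
  obtain ⟨u', t', b', hu', hAut', -, A'', -, -, -, -, hA''v, -, hw'⟩ :=
    exists_shift_onWalk hk hkL (Nat.succ_pos n) hq ih hqA' hspan hvb hA'vb
  have hxor : ∀ a b : Fin 4, 0 ^^^ b = a → b = a := by decide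
  obtain ⟨rfl, ht'⟩ := hw.bottom (Nat.succ_pos n) hu'
    (by rw [hAut']; exact bondLetter_ne_zero t')
  have hv1 : diagOf v = a + (n + 1 : ℕ) := by
    have := eq_sub_of_add_eq hv
    rw [this]; push_cast; ring
  have hv_walk : v = walk u t (n + 1) := by
    rw [walk_succ_left]
    exact hw.eq_walk (Nat.lt_succ_self n) (by rw [hv1]; push_cast; ring) hA'v
  have hvb_walk : v + bondDir L b = walk u t (n + 2) := by
    rw [walk_succ_left, walk_succ_left]
    have htt : t' = !t := bondLetter_injective (hAut'.symm.trans ht')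
    subst htt
    exact hw'.eq_walk (Nat.lt_succ_self n)
      (by rw [diagOf_add_bondDir, hv1]; push_cast; ring) hA''v
  have hb_eq : b = stepType t (n + 1) := by
    rw [walk, ← hv_walk] at hvb_walk
    exact bondDir_injective hL (add_left_cancel hvb_walk)
  obtain ⟨u₁, t₁, hw₁⟩ := ih A a hqA hA
  obtain ⟨rfl, ht₁⟩ := hw₁.bottom (Nat.succ_pos n) hu (by rw [hAu]; exact bondLetter_ne_zero t)
  obtain rfl : t = t₁ := bondLetter_injective (hAu.symm.trans ht₁)
  refine ⟨u₁, t, hu, fun j hj x hx => ?_⟩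
  rcases Nat.lt_succ_iff_lt_or_eq.mp hj with hj' | rfl
  · rw [hw₁ j hj' x hx, if_neg (by omega : ¬ j + 1 = n + 2)]
  rw [if_neg (Nat.succ_ne_zero n), if_pos rfl, ← hv_walk, Nat.add_sub_cancel]
  have hA'x := hw n (Nat.lt_succ_self n) x (by rw [hx]; push_cast; ring)
  rw [← walk_succ_left, ← hv_walk] at hA'x
  have hxu : x ≠ u₁ := by
    rintro rfl
    have := eq_of_eq_add_natCast (i := 0) (by omega) (by omega) (by simpa using hu) hx
    omega
  have hxvb : x ≠ v + bondDir L b := by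
    rintro rfl
    rw [diagOf_add_bondDir, hv] at hx
    have := eq_of_eq_add_natCast (by omega) (by omega) hx rfl
    omega
  by_cases hxv : x = v
  · subst hxv
    rw [if_pos rfl] at hA'x ⊢
    rw [hA'] at hA'x
    simp only [specMul, bond, hxu, if_true, if_false] at hA'x
    rw [stepType_succ, stepType_not] at hb_eq
    subst hb_eq
    rcases n with _ | n
    · have hxt : x = u₁ + bondDir L t := by simpa [walk, stepType] using hv_walk
      simp only [← hxt, if_true, stepType, Nat.zero_mod] at hA'x ⊢
      have : ∀ (t : Bool) (w : Fin 4),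
          bondLetter t ^^^ (bondLetter (!t) ^^^ w) = bondLetter (!t) → w = bondLetter t := by decide
      exact this _ _ hA'x
    · have hxt : x ≠ u₁ + bondDir L t := by
        rintro rfl
        have := eq_of_eq_add_natCast (i := 1) (by omega) (by omega)
          (by rw [diagOf_add_bondDir, hu]; simp) hx
        omega
      simp only [hxt, if_false, Nat.succ_ne_zero] at hA'x
      have : ∀ (t : Bool) (w : Fin 4),
          0 ^^^ (bondLetter (!t) ^^^ w) = 3 → w = bondLetter t := by decide
      exact this _ _ hA'x
  · rw [if_neg hxv] at hA'x ⊢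
    have hxt : x ≠ u₁ + bondDir L t := by
      rintro rfl
      exact hA'u hA'x
    rw [hA'] at hA'x
    simp only [specMul, bond, hxu, hxv, hxvb, hxt, if_false] at hA'x
    exact hxor _ _ (hxor _ _ hA'x)

/-- A full staircase is a standard-form product. -/
lemma eq_Cspec_of_walk {k j₀ : ℕ} (hk : 2 ≤ k) {A : PSpec L} {a : ZMod L}
    (hwin : DiagBoundAt L A a k) {u u₁ : Site L} {t : Bool} (hu : diagOf u = a)
    (hstair : ∀ j, stair L u₁ (j₀ + j) = walk u t j)
    (hl : bondLetter t = endL j₀) (hr : bondLetter (stepType t (k - 2)) = endR k j₀)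
    (hA : ∀ j < k, ∀ x, diagOf x = a + (j : ZMod L) →
      A x = if x = walk u t j then
        (if j = 0 then bondLetter t else if j + 1 = k then bondLetter (stepType t (k - 2)) else 3)
        else 0) :
    A = Cspec L k j₀ u₁ := by
  funext x
  have hval : ∀ j < k, A (walk u t j)
      = if j = 0 then bondLetter t
        else if j + 1 = k then bondLetter (stepType t (k - 2)) else 3 := by
    intro j hj
    rw [hA j hj _ (by rw [diagOf_walk, hu]), if_pos rfl]
  have h0 : stair L u₁ j₀ = walk u t 0 := hstair 0
  have h1 : stair L u₁ (j₀ + k - 1) = walk u t (k - 1) := by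
    rw [← hstair, Nat.add_sub_assoc (by omega)]
  unfold Cspec
  rw [h0, h1]
  split_ifs with hx0 hx1 hx2
  · rw [hx0, hval 0 (by omega), if_pos rfl, hl]
  · rw [hx1, hval (k - 1) (by omega), if_neg (by omega), if_pos (by omega), hr]
  · obtain ⟨i, hi, rfl⟩ := Finset.mem_image.mp hx2
    rw [Finset.mem_Icc] at hi
    obtain ⟨j, rfl⟩ := Nat.exists_eq_add_of_le (show j₀ ≤ i by omega)
    rw [hstair, hval j (by omega), if_neg (by omega), if_neg (by omega)]
  · by_contra hAx
    have hj := hwin x hAx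
    have hAj := hA _ hj x (eq_add_val_sub a (diagOf x))
    have hx : x = walk u t (x.1 + x.2 - a).val := by
      by_contra hne
      exact hAx (by rw [hAj, if_neg hne])
    set j := (x.1 + x.2 - a).val
    have hj0 : j ≠ 0 := fun h => hx0 (by rw [hx, h])
    have hj1 : j ≠ k - 1 := fun h => hx1 (by rw [hx, h])
    refine hx2 (Finset.mem_image.mpr ⟨j₀ + j, Finset.mem_Icc.mpr ⟨by omega, by omega⟩, ?_⟩)
    rw [hstair, ← hx]

end Rigidity

/-- For the compass model with an arbitrary uniform magnetic
field (`Jx ≠ 0`, `Jy ≠ 0`) and `2 ≤ k̄ ≤ L/2`, the first-step conclusion remains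
valid: the coefficient `q_σ` of a local conserved quantity vanishes for every
Pauli product `σ` with `Diag σ = k̄` unless `σ` is a standard-form product
`C^k̄_1` or `C^k̄_2` based at some site. -/
theorem coefficient_vanishes_unless_standard_form_with_field
    (L : ℕ) [NeZero L] (Jx Jy hx hy hz : ℝ) (hJx : Jx ≠ 0) (hJy : Jy ≠ 0)
    (k : ℕ) (hk : 2 ≤ k) (hkL : 2 * k ≤ L)
    (q : PSpec L → ℂ)
    (hsupp : ∀ σ : PSpec L, q σ ≠ 0 → σ ≠ 0 ∧ Diag L σ ≤ k)
    (hcons : opComm L (Hfield L Jx Jy hx hy hz) (Qop L q) = 0)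
    (σ : PSpec L) (hdiag : Diag L σ = k) (hq : q σ ≠ 0) :
    ∃ u1 : Site L, σ = Cspec L k 1 u1 ∨ σ = Cspec L k 2 u1 := by
  have hcon := isLocallyConserved_of_opComm_eq_zero hJx hJy hsupp hcons
  obtain ⟨a, ha⟩ := exists_spans_Diag hk hkL hdiag
  obtain ⟨u, t, hu, hwalk⟩ := exists_full_walk hk hkL hcon hq ha
  cases t
  · refine ⟨u - (1, 0), Or.inr ?_⟩
    refine eq_Cspec_of_walk hk ha.1 hu (fun j => ?_) rfl ?_ hwalk
    · rw [stair_two_add_eq_walk, sub_add_cancel]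
    · rcases Nat.even_or_odd' k with ⟨i, rfl | rfl⟩
      · simp [endR, stepType, bondLetter, show (2 * i - 2) % 2 = 0 by omega]
      · simp [endR, stepType, bondLetter, show (2 * i - 1) % 2 = 1 by omega,
          show (2 * i + 1) % 2 = 1 by omega]
  · refine ⟨u, Or.inl ?_⟩
    refine eq_Cspec_of_walk hk ha.1 hu (fun j => stair_eq_walk u j) rfl ?_ hwalk
    rcases Nat.even_or_odd' k with ⟨i, rfl | rfl⟩
    · simp [endR, stepType, bondLetter, show (2 * i - 2) % 2 = 0 by omega]
    · simp [endR, stepType, bondLetter, show (2 * i - 1) % 2 = 1 by omega,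
        show (2 * i + 1) % 2 = 1 by omega]
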